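/- arXiv:2307.15383 — 4 statements merged into one kernel-verified Lean document; each statement's English description precedes it below -/
import Mathlib

section
/- Let C be an executable simulation campaign. Then for every simulator state (x, w, m) traversed by C, the system-state component satisfies x = List.foldl δ x0 w (i.e., the stored input trace w drives the system from its initial state x0 to x), and moreover every entry (x', w') in the range of the memory m satisfies x' = List.foldl δ x0 w'. -/
/-- Simulator commands: `out`, `load id`, `store id`, `free id`, and `run u k`
(with `k` a positive natural number, the duration of the run). -/
inductive SimCmd (U : Type*) (ID : Type*) where
  | out : SimCmd U ID
  | load (id : ID) : SimCmd U ID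
  | store (id : ID) : SimCmd U ID
  | free (id : ID) : SimCmd U ID
  | run (u : U) (k : ℕ+) : SimCmd U ID

/-- A simulator state: either a triple `(x, w, m)` (system state, input trace injected so
far, simulator memory as a finite partial map from identifiers to pairs of a system state
and an input trace), or a distinguished error state. -/
inductive SimState (X : Type*) (U : Type*) (ID : Type*) where
  | ok (x : X) (w : List U) (m : Finmap (fun _ : ID => X × List U)) : SimState X U ID
  | err : SimState X U ID

variable {X U ID : Type*} [DecidableEq ID]

/-- Semantics of simulator commands on simulator states. -/
def SimState.step (δ : X → U → X) : SimState X U ID → SimCmd U ID → SimState X U ID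
  | .err, _ => .err
  | .ok x w m, .out => .ok x w m
  | .ok _ _ m, .load id =>
      match m.lookup id with
      | some p => .ok p.1 p.2 m
      | none => .err
  | .ok x w m, .store id =>
      match m.lookup id with
      | some _ => .err
      | none => .ok x w (m.insert id (x, w))
  | .ok x w m, .free id =>
      match m.lookup id with
      | some _ => .ok x w (m.erase id)
      | none => .err
  | .ok x w m, .run u k =>
      .ok (List.foldl δ x (List.replicate k u)) (w ++ List.replicate k u) m

/-- The initial simulator state `(x0, [], ∅)`. -/
def initState (x0 : X) : SimState X U ID := .ok x0 [] ∅

/-- The simulator states traversed by a simulation campaign (a list of commands),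
starting from the initial simulator state. -/
def traversed (δ : X → U → X) (x0 : X) (C : List (SimCmd U ID)) : List (SimState X U ID) :=
  List.scanl (SimState.step δ) (initState x0) C

/-- A simulation campaign is executable if none of its traversed states is the error state. -/
def Executable (δ : X → U → X) (x0 : X) (C : List (SimCmd U ID)) : Prop :=
  ∀ s ∈ traversed δ x0 C, s ≠ SimState.err

/-- The time advancement of a single command. -/
def cmdLen : SimCmd U ID → ℕ
  | .run _ k => k
  | _ => 0

/-- The length of a simulation campaign: the sum of the durations of its run commands. -/
def campaignLen (C : List (SimCmd U ID)) : ℕ := (C.map cmdLen).sum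

/-- The number of entries in the memory of a simulator state. -/
def memSize : SimState X U ID → ℕ
  | .ok _ _ m => m.keys.card
  | .err => 0

/-- The required simulator memory of a campaign: the maximum number of memory entries
over its traversed states. -/
def requiredMem (δ : X → U → X) (x0 : X) (C : List (SimCmd U ID)) : ℕ :=
  ((traversed δ x0 C).map memSize).foldr max 0

/-- The output-trace sequence of a campaign run from a given simulator state: the list of
the `w`-components of the states at which its `out` commands are executed. -/
def outputsFrom (δ : X → U → X) : SimState X U ID → List (SimCmd U ID) → List (List U)
  | _, [] => []
  | s, c :: rest =>
      (match c, s with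
       | .out, .ok _ w _ => [w]
       | _, _ => []) ++ outputsFrom δ (SimState.step δ s c) rest

/-- The output-trace sequence of a simulation campaign. -/
def outputs (δ : X → U → X) (x0 : X) (C : List (SimCmd U ID)) : List (List U) :=
  outputsFrom δ (initState x0) C

/-- The system state is reached from `x0` by the recorded input trace, and so is every
state stored in memory; the error state is vacuously consistent. -/
def SimState.Consistent (δ : X → U → X) (x0 : X) : SimState X U ID → Prop
  | .ok x w m => x = List.foldl δ x0 w ∧
      ∀ (id : ID) (x' : X) (w' : List U), m.lookup id = some (x', w') →
        x' = List.foldl δ x0 w'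
  | .err => True

theorem SimState.consistent_initState (δ : X → U → X) (x0 : X) :
    (initState x0 : SimState X U ID).Consistent δ x0 :=
  ⟨rfl, fun id x' w' h => by simp at h⟩

theorem SimState.Consistent.step {δ : X → U → X} {x0 : X} {s : SimState X U ID}
    (hs : s.Consistent δ x0) (c : SimCmd U ID) : (s.step δ c).Consistent δ x0 := by
  cases s with
  | err => trivial
  | ok x w m =>
    obtain ⟨hx, hm⟩ := hs
    cases c with
    | out => exact ⟨hx, hm⟩
    | load id =>
      simp only [SimState.step]
      split
      · rename_i p hp
        exact ⟨hm id p.1 p.2 hp, hm⟩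
      · trivial
    | store id =>
      simp only [SimState.step]
      split
      · trivial
      · refine ⟨hx, fun id' x' w' h => ?_⟩
        by_cases hid : id' = id
        · subst hid
          rw [Finmap.lookup_insert] at h
          cases h
          exact hx
        · rw [Finmap.lookup_insert_of_ne _ hid] at h
          exact hm id' x' w' h
    | free id =>
      simp only [SimState.step]
      split
      · refine ⟨hx, fun id' x' w' h => ?_⟩
        by_cases hid : id' = id
        · subst hid
          rw [Finmap.lookup_erase] at h
          cases h
        · rw [Finmap.lookup_erase_ne hid] at h
          exact hm id' x' w' h
      · trivial
    | run u k => exact ⟨by rw [List.foldl_append, ← hx], hm⟩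

theorem SimState.Consistent.of_mem_scanl {δ : X → U → X} {x0 : X} (C : List (SimCmd U ID))
    {s t : SimState X U ID} (hs : s.Consistent δ x0)
    (ht : t ∈ List.scanl (SimState.step δ) s C) : t.Consistent δ x0 := by
  induction C generalizing s with
  | nil =>
    rw [List.scanl_nil, List.mem_singleton] at ht
    exact ht ▸ hs
  | cons c C ih =>
    rw [List.scanl_cons, List.mem_cons] at ht
    rcases ht with rfl | ht
    · exact hs
    · exact ih (hs.step c) ht

/-- For an executable simulation campaign `C`, every traversed simulator
state `(x, w, m)` satisfies `x = List.foldl δ x0 w`, and every entry `(x', w')` in the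
range of the memory `m` satisfies `x' = List.foldl δ x0 w'`. -/
theorem stmt0 [Countable ID] (δ : X → U → X) (x0 : X) (C : List (SimCmd U ID))
    (hexec : Executable δ x0 C) :
    ∀ s ∈ traversed δ x0 C, ∀ (x : X) (w : List U)
      (m : Finmap (fun _ : ID => X × List U)), s = SimState.ok x w m →
      x = List.foldl δ x0 w ∧
      ∀ (id : ID) (x' : X) (w' : List U), m.lookup id = some (x', w') →
        x' = List.foldl δ x0 w' := by
  rintro s hs x w m rfl
  exact SimState.Consistent.of_mem_scanl C (SimState.consistent_initState δ x0) hs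
end

section
/- Let L be a finite list of pairwise distinct nonempty input traces (lists over U). Then there exists an executable simulation campaign C whose output-trace sequence is exactly L and whose length equals the number of distinct nonempty prefixes of elements of L (that is, the cardinality of the set of all nonempty lists that are a prefix of some element of L). -/
variable {X U ID : Type*} [DecidableEq ID]

theorem foldl_step_err (δ : X → U → X) (C : List (SimCmd U ID)) :
    C.foldl (SimState.step δ) .err = .err := by
  induction C with
  | nil => rfl
  | cons c C ih => simpa [SimState.step] using ih

/-- The error state is absorbing, so only the final state matters for executability. -/
theorem ne_err_of_mem_scanl (δ : X → U → X) (C : List (SimCmd U ID)) (s : SimState X U ID)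
    (h : C.foldl (SimState.step δ) s ≠ .err) :
    ∀ t ∈ C.scanl (SimState.step δ) s, t ≠ .err := by
  induction C generalizing s with
  | nil => simpa using h
  | cons c C ih =>
    intro t ht
    rw [List.scanl_cons, List.mem_cons] at ht
    rcases ht with rfl | ht
    · rintro rfl
      exact h (foldl_step_err δ _)
    · exact ih _ h t ht

theorem outputsFrom_append (δ : X → U → X) (C D : List (SimCmd U ID)) (s : SimState X U ID) :
    outputsFrom δ s (C ++ D) =
      outputsFrom δ s C ++ outputsFrom δ (C.foldl (SimState.step δ) s) D := by
  induction C generalizing s with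
  | nil => rfl
  | cons c C ih => simp [outputsFrom, ih]

theorem campaignLen_append {V J : Type*} (C D : List (SimCmd V J)) :
    campaignLen (C ++ D) = campaignLen C + campaignLen D := by
  simp [campaignLen]

/-- The memory `m` holds, for each trace in `S`, the state reached by that trace. -/
def Stores (δ : X → U → X) (x0 : X) (m : Finmap (fun _ : ID => X × List U))
    (S : Set (List U)) : Prop :=
  ∀ p ∈ S, ∃ id, m.lookup id = some (p.foldl δ x0, p)

theorem exists_lookup_eq_none [Infinite ID] (m : Finmap (fun _ : ID => X × List U)) :
    ∃ id, m.lookup id = none := by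
  obtain ⟨id, hid⟩ := Infinite.exists_notMem_finset m.keys
  exact ⟨id, Finmap.lookup_eq_none.2 (by rwa [← Finmap.mem_keys])⟩

theorem Stores.insert {δ : X → U → X} {x0 : X} {m : Finmap (fun _ : ID => X × List U)}
    {S : Set (List U)} (h : Stores δ x0 m S) {id : ID} (hid : m.lookup id = none)
    (T : List U) : Stores δ x0 (m.insert id (T.foldl δ x0, T)) (insert T S) := by
  rintro p (rfl | hp)
  · exact ⟨id, Finmap.lookup_insert _⟩
  · obtain ⟨i, hi⟩ := h p hp
    refine ⟨i, ?_⟩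
    rw [Finmap.lookup_insert_of_ne _ (by rintro rfl; simp [hid] at hi), hi]

theorem exists_campaign_loading {δ : X → U → X} {x0 : X} {S : Set (List U)}
    (hS : ∀ p q, q ∈ S → p <+: q → p ∈ S)
    {m : Finmap (fun _ : ID => X × List U)} (hm : Stores δ x0 m S)
    {T : List U} (hT : T ∈ S) (x : X) (w : List U) :
    ∃ (C : List (SimCmd U ID)) (m' : Finmap (fun _ : ID => X × List U)),
      C.foldl (SimState.step δ) (.ok x w m) = .ok (T.foldl δ x0) T m' ∧
      outputsFrom δ (.ok x w m) C = [] ∧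
      Stores δ x0 m' (S ∪ {p | p <+: T}) ∧
      (campaignLen C : ℕ∞) + S.encard = (S ∪ {p | p <+: T}).encard := by
  obtain ⟨id, hid⟩ := hm T hT
  have hU : S ∪ {p | p <+: T} = S := Set.union_eq_left.2 fun p hp => hS p T hT hp
  refine ⟨[.load id], m, ?_, ?_, ?_, ?_⟩
  · simp [SimState.step, hid]
  · simp [outputsFrom]
  · rwa [hU]
  · simp [hU, campaignLen, cmdLen]

theorem exists_campaign_reaching [Infinite ID] (δ : X → U → X) (x0 : X) (S : Set (List U))
    (hnil : [] ∈ S) (hS : ∀ p q, q ∈ S → p <+: q → p ∈ S)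
    (x : X) (w : List U) (m : Finmap (fun _ : ID => X × List U)) (hm : Stores δ x0 m S)
    (T : List U) :
    ∃ (C : List (SimCmd U ID)) (m' : Finmap (fun _ : ID => X × List U)),
      C.foldl (SimState.step δ) (.ok x w m) = .ok (T.foldl δ x0) T m' ∧
      outputsFrom δ (.ok x w m) C = [] ∧
      Stores δ x0 m' (S ∪ {p | p <+: T}) ∧
      (campaignLen C : ℕ∞) + S.encard = (S ∪ {p | p <+: T}).encard := by
  induction T using List.reverseRecOn with
  | nil => exact exists_campaign_loading hS hm hnil x w
  | append_singleton T u ih =>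
    by_cases hT : T ++ [u] ∈ S
    · exact exists_campaign_loading hS hm hT x w
    · obtain ⟨C, m', hC, hout, hm', hlen⟩ := ih
      obtain ⟨id, hid⟩ := exists_lookup_eq_none m'
      have hU : S ∪ {p | p <+: T ++ [u]} = insert (T ++ [u]) (S ∪ {p | p <+: T}) := by
        ext p
        simp only [Set.mem_union, Set.mem_ofPred_eq, Set.mem_insert_iff, List.prefix_concat_iff]
        tauto
      have hnot : T ++ [u] ∉ S ∪ {p | p <+: T} := by
        rintro (h | h)
        · exact hT h
        · simpa using List.IsPrefix.length_le h
      refine ⟨C ++ [.run u 1, .store id], m'.insert id ((T ++ [u]).foldl δ x0, T ++ [u]),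
        ?_, ?_, ?_, ?_⟩
      · simp [hC, SimState.step, hid]
      · simp [outputsFrom_append, hout, outputsFrom]
      · rw [hU]
        exact hm'.insert hid _
      · rw [hU, Set.encard_insert_of_notMem hnot, ← hlen, campaignLen_append]
        simp [campaignLen, cmdLen, add_right_comm]

theorem exists_campaign_outputting [Infinite ID] (δ : X → U → X) (x0 : X) (L : List (List U))
    (S : Set (List U)) (hnil : [] ∈ S) (hS : ∀ p q, q ∈ S → p <+: q → p ∈ S)
    (x : X) (w : List U) (m : Finmap (fun _ : ID => X × List U)) (hm : Stores δ x0 m S) :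
    ∃ C : List (SimCmd U ID),
      C.foldl (SimState.step δ) (.ok x w m) ≠ .err ∧
      outputsFrom δ (.ok x w m) C = L ∧
      (campaignLen C : ℕ∞) + S.encard = (S ∪ {p | ∃ T ∈ L, p <+: T}).encard := by
  induction L generalizing S x w m with
  | nil => exact ⟨[], by simp, rfl, by simp [campaignLen]⟩
  | cons T L ih =>
    obtain ⟨C, m', hC, hout, hm', hlen⟩ :=
      exists_campaign_reaching δ x0 S hnil hS x w m hm T
    obtain ⟨D, hD, hout', hlen'⟩ := ih (S ∪ {p | p <+: T}) (.inl hnil)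
      (fun p q hq hpq => hq.imp (hS p q · hpq) hpq.trans) (T.foldl δ x0) T m' hm'
    have hU : S ∪ {p | ∃ V ∈ T :: L, p <+: V} =
        S ∪ {p | p <+: T} ∪ {p | ∃ V ∈ L, p <+: V} := by
      ext p
      simp [or_assoc]
    refine ⟨C ++ .out :: D, ?_, ?_, ?_⟩
    · simpa [hC, SimState.step] using hD
    · simp [outputsFrom_append, hC, hout, outputsFrom, SimState.step, hout']
    · rw [hU, ← hlen', ← hlen, campaignLen_append]
      simp [campaignLen, cmdLen, add_assoc, add_left_comm]

/-- For any finite list `L` of pairwise distinct nonempty input traces,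
there exists an executable simulation campaign whose output-trace sequence is exactly `L`
and whose length equals the number of distinct nonempty prefixes of elements of `L`. -/
theorem stmt2 [Countable ID] [Infinite ID] (δ : X → U → X) (x0 : X)
    (L : List (List U)) (hnd : L.Nodup) (hne : ∀ T ∈ L, T ≠ []) :
    ∃ C : List (SimCmd U ID), Executable δ x0 C ∧ outputs δ x0 C = L ∧
      campaignLen C = {p : List U | p ≠ [] ∧ ∃ T ∈ L, p <+: T}.ncard := by
  obtain ⟨id⟩ := (inferInstance : Nonempty ID)
  have hm : Stores δ x0 ((∅ : Finmap (fun _ : ID => X × List U)).insert id (x0, [])) {[]} := by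
    rintro p rfl
    exact ⟨id, Finmap.lookup_insert _⟩
  obtain ⟨C, hC, hout, hlen⟩ := exists_campaign_outputting δ x0 L {[]} rfl
    (by rintro p q rfl hp; simpa using hp) x0 [] _ hm
  have hstep : SimState.step δ (initState x0) (.store id) =
      .ok x0 [] ((∅ : Finmap (fun _ : ID => X × List U)).insert id (x0, [])) := by
    simp [SimState.step, initState]
  refine ⟨.store id :: C, ne_err_of_mem_scanl δ _ _ ?_, ?_, ?_⟩
  · rwa [List.foldl_cons, hstep]
  · simpa [outputs, outputsFrom, hstep] using hout
  · have hU : ({[]} ∪ {p | ∃ T ∈ L, p <+: T} : Set (List U)) =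
        insert [] {p : List U | p ≠ [] ∧ ∃ T ∈ L, p <+: T} := by
      ext p
      by_cases hp : p = [] <;> simp [hp]
    rw [hU, Set.encard_insert_of_notMem (by simp), Set.encard_singleton] at hlen
    replace hlen := WithTop.add_right_cancel ENat.one_ne_top hlen
    rw [Set.ncard, ← hlen, ENat.toNat_natCast]
    simp [campaignLen, cmdLen]
end

section
/- Let S be a finite set of nonempty input traces (lists over U) and let C be any executable simulation campaign whose output-trace sequence contains every element of S. Then the length of C is at least the number of distinct nonempty prefixes of elements of S (the cardinality of the set of all nonempty lists that are a prefix of some element of S). -/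
variable {X U ID : Type*} [DecidableEq ID]

/-- `P` contains every nonempty prefix of `w`. -/
def CoversPrefixes (P : Finset (List U)) (w : List U) : Prop :=
  ∀ p, p ≠ [] → p <+: w → p ∈ P

/-- `P` contains every nonempty prefix of the current input trace and of all stored ones. -/
def SimState.CoveredBy (P : Finset (List U)) : SimState X U ID → Prop
  | .err => True
  | .ok _ w m => CoversPrefixes P w ∧ ∀ id q, m.lookup id = some q → CoversPrefixes P q.2

theorem CoversPrefixes.mono {P Q : Finset (List U)} {w : List U} (h : P ⊆ Q)
    (hw : CoversPrefixes P w) : CoversPrefixes Q w :=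
  fun p hp hpw => h (hw p hp hpw)

theorem CoversPrefixes.exists_append_replicate {P : Finset (List U)} {w : List U}
    (hw : CoversPrefixes P w) (u : U) (k : ℕ) :
    ∃ Q, P ⊆ Q ∧ Q.card ≤ P.card + k ∧ CoversPrefixes Q (w ++ List.replicate k u) := by
  classical
  refine ⟨P ∪ (Finset.range k).image (fun i => w ++ List.replicate (i + 1) u),
    Finset.subset_union_left, ?_, ?_⟩
  · refine (Finset.card_union_le _ _).trans (Nat.add_le_add_left ?_ _)
    exact Finset.card_image_le.trans (Finset.card_range k).le
  · intro p hp hpw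
    rw [Finset.mem_union]
    rcases List.prefix_or_prefix_of_prefix hpw (List.prefix_append w _) with h | ⟨t, rfl⟩
    · exact Or.inl (hw p hp h)
    · have ht := (List.prefix_append_right_inj w).mp hpw
      obtain ⟨hlen, ht⟩ := List.prefix_replicate_iff.mp ht
      rcases Nat.eq_zero_or_pos t.length with h0 | hpos
      · rw [List.length_eq_zero_iff.mp h0, List.append_nil] at hp ⊢
        exact Or.inl (hw w hp List.prefix_rfl)
      · refine Or.inr (Finset.mem_image.mpr ⟨t.length - 1, Finset.mem_range.mpr (by omega), ?_⟩)
        rw [Nat.sub_add_cancel hpos, ← ht]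

theorem SimState.CoveredBy.exists_step (δ : X → U → X) {P : Finset (List U)}
    {s : SimState X U ID} (hs : s.CoveredBy P) (c : SimCmd U ID) :
    ∃ Q, P ⊆ Q ∧ Q.card ≤ P.card + cmdLen c ∧ (s.step δ c).CoveredBy Q := by
  cases s with
  | err => exact ⟨P, subset_rfl, Nat.le_add_right _ _, by cases c <;> trivial⟩
  | ok x w m =>
    obtain ⟨hw, hm⟩ := hs
    cases c with
    | out => exact ⟨P, subset_rfl, Nat.le_add_right _ _, hw, hm⟩
    | load id =>
      refine ⟨P, subset_rfl, Nat.le_add_right _ _, ?_⟩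
      simp only [SimState.step]
      split
      next q hq => exact ⟨hm id q hq, hm⟩
      next => trivial
    | store id =>
      refine ⟨P, subset_rfl, Nat.le_add_right _ _, ?_⟩
      simp only [SimState.step]
      split
      next => trivial
      next =>
        refine ⟨hw, fun id' q hq => ?_⟩
        by_cases h : id' = id
        · subst h
          rw [Finmap.lookup_insert] at hq
          cases hq
          exact hw
        · rw [Finmap.lookup_insert_of_ne _ h] at hq
          exact hm id' q hq
    | free id =>
      refine ⟨P, subset_rfl, Nat.le_add_right _ _, ?_⟩
      simp only [SimState.step]
      split
      next =>
        refine ⟨hw, fun id' q hq => ?_⟩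
        by_cases h : id' = id
        · subst h
          rw [Finmap.lookup_erase] at hq
          cases hq
        · rw [Finmap.lookup_erase_ne h] at hq
          exact hm id' q hq
      next => trivial
    | run u k =>
      obtain ⟨Q, hPQ, hcard, hQ⟩ := hw.exists_append_replicate u k
      exact ⟨Q, hPQ, hcard, hQ, fun id q hq => (hm id q hq).mono hPQ⟩

theorem SimState.CoveredBy.exists_outputsFrom (δ : X → U → X) (C : List (SimCmd U ID))
    {P : Finset (List U)} {s : SimState X U ID} (hs : s.CoveredBy P) :
    ∃ Q, P ⊆ Q ∧ Q.card ≤ P.card + campaignLen C ∧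
      ∀ T ∈ outputsFrom δ s C, CoversPrefixes Q T := by
  induction C generalizing P s with
  | nil => exact ⟨P, subset_rfl, Nat.le_add_right _ _, by simp [outputsFrom]⟩
  | cons c C ih =>
    obtain ⟨R, hPR, hR, hstep⟩ := hs.exists_step δ c
    obtain ⟨Q, hRQ, hQ, hout⟩ := ih hstep
    refine ⟨Q, hPR.trans hRQ, ?_, fun T hT => ?_⟩
    · simp only [campaignLen, List.map_cons, List.sum_cons] at hQ ⊢
      omega
    · unfold outputsFrom at hT
      rw [List.mem_append] at hT
      rcases hT with hT | hT
      · split at hT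
        next x w m =>
          rw [List.mem_singleton] at hT
          subst hT
          exact hs.1.mono (hPR.trans hRQ)
        next => cases hT
      · exact hout T hT


/-- If `C` is an executable simulation campaign whose output-trace sequence
contains every element of a finite set `S` of nonempty input traces, then the length of
`C` is at least the number of distinct nonempty prefixes of elements of `S`. -/
theorem stmt3 [Countable ID] (δ : X → U → X) (x0 : X)
    (S : Finset (List U)) (hne : ∀ T ∈ S, T ≠ [])
    (C : List (SimCmd U ID)) (hexec : Executable δ x0 C)
    (hcov : ∀ T ∈ S, T ∈ outputs δ x0 C) :
    {p : List U | p ≠ [] ∧ ∃ T ∈ S, p <+: T}.ncard ≤ campaignLen C := by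
  have hinit : (initState x0 : SimState X U ID).CoveredBy ∅ := by
    refine ⟨fun p hp hpw => absurd (List.prefix_nil.mp hpw) hp, fun id q hq => ?_⟩
    rw [Finmap.lookup_empty] at hq
    cases hq
  obtain ⟨Q, -, hcard, hQ⟩ := hinit.exists_outputsFrom δ C
  have hsub : {p : List U | p ≠ [] ∧ ∃ T ∈ S, p <+: T} ⊆ (Q : Set (List U)) := by
    rintro p ⟨hp, T, hT, hpT⟩
    exact hQ T (hcov T hT) p hp hpT
  calc _ ≤ (Q : Set (List U)).ncard := Set.ncard_le_ncard hsub Q.finite_toSet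
    _ = Q.card := Set.ncard_coe_finset Q
    _ ≤ campaignLen C := by simpa using hcard
end

section
/- Let L be a finite list of pairwise distinct nonempty input traces (lists over U) and let m* be the number of distinct longest shared prefixes (LSPs) of the set S of elements of L. Then there exists an executable simulation campaign C whose output-trace sequence is exactly L, whose required memory is at most m*, and whose length equals the number of distinct nonempty prefixes of elements of S; in particular, restricting the simulator memory capacity to m* entries does not increase the minimal achievable campaign length. -/
variable {X U ID : Type*} [DecidableEq ID]

/-- The longest common prefix of two lists. -/
def lcp [DecidableEq U] : List U → List U → List U
  | a :: as, b :: bs => if a = b then a :: lcp as bs else []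
  | _, _ => []

section LongestCommonPrefix

variable [DecidableEq U]

theorem lcp_prefix_left (a b : List U) : lcp a b <+: a := by
  induction a generalizing b with
  | nil => simp [lcp]
  | cons x a ih =>
    cases b with
    | nil => simp [lcp]
    | cons y b =>
      by_cases h : x = y
      · simpa [lcp, h] using ih b
      · simp [lcp, h]

theorem lcp_prefix_right (a b : List U) : lcp a b <+: b := by
  induction a generalizing b with
  | nil => simp [lcp]
  | cons x a ih =>
    cases b with
    | nil => simp [lcp]
    | cons y b =>
      by_cases h : x = y
      · simpa [lcp, h] using ih b
      · simp [lcp, h]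

theorem prefix_lcp {p a b : List U} (ha : p <+: a) (hb : p <+: b) : p <+: lcp a b := by
  induction p generalizing a b with
  | nil => simp
  | cons x p ih =>
    obtain ⟨s, rfl⟩ := ha
    obtain ⟨t, rfl⟩ := hb
    simpa [lcp] using ih (List.prefix_append p s) (List.prefix_append p t)

theorem finite_setOf_lcp (L : List (List U)) :
    {p : List U | ∃ a ∈ L, ∃ b ∈ L, a ≠ b ∧ p = lcp a b}.Finite := by
  refine ((L.toFinset ×ˢ L.toFinset).image fun q => lcp q.1 q.2).finite_toSet.subset ?_
  rintro p ⟨a, ha, b, hb, -, rfl⟩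
  simp only [Finset.coe_image, Set.mem_image]
  exact ⟨(a, b), by simp [ha, hb], rfl⟩

end LongestCommonPrefix

/-- Running `C` from `s` never errs, never uses more than `N` memory entries, outputs `os`, and
has length `n`. -/
structure RunsWithin (δ : X → U → X) (N : ℕ) (s : SimState X U ID) (C : List (SimCmd U ID))
    (os : List (List U)) (n : ℕ) : Prop where
  ok : ∀ t ∈ List.scanl (SimState.step δ) s C, t ≠ .err ∧ memSize t ≤ N
  outputs_eq : outputsFrom δ s C = os
  len_eq : campaignLen C = n

namespace RunsWithin

variable {δ : X → U → X} {N n : ℕ} {C : List (SimCmd U ID)} {os : List (List U)}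
  {x : X} {w : List U} {m : Finmap fun _ : ID => X × List U}

theorem nil (hm : m.keys.card ≤ N) : RunsWithin δ N (.ok x w m) [] [] 0 :=
  ⟨by simpa [memSize] using hm, rfl, rfl⟩

theorem cons_out (hm : m.keys.card ≤ N) (h : RunsWithin δ N (.ok x w m) C os n) :
    RunsWithin δ N (.ok x w m) (.out :: C) (w :: os) n where
  ok := by
    have := h.ok
    simp only [List.scanl_cons, List.mem_cons, forall_eq_or_imp]
    exact ⟨⟨by simp, hm⟩, this⟩
  outputs_eq := by simp [outputsFrom, SimState.step, h.outputs_eq]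
  len_eq := by simp [campaignLen, cmdLen, ← h.len_eq]

theorem cons_load {id : ID} {q : X × List U} (hm : m.keys.card ≤ N) (hq : m.lookup id = some q)
    (h : RunsWithin δ N (.ok q.1 q.2 m) C os n) :
    RunsWithin δ N (.ok x w m) (.load id :: C) os n := by
  have hs : SimState.step δ (.ok x w m) (.load id) = .ok q.1 q.2 m := by simp [SimState.step, hq]
  refine ⟨?_, ?_, ?_⟩
  · simp only [List.scanl_cons, List.mem_cons, forall_eq_or_imp, hs]
    exact ⟨⟨by simp, hm⟩, h.ok⟩
  · simp [outputsFrom, hs, h.outputs_eq]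
  · simp [campaignLen, cmdLen, ← h.len_eq]

theorem cons_store {id : ID} (hm : m.keys.card ≤ N) (hid : m.lookup id = none)
    (h : RunsWithin δ N (.ok x w (m.insert id (x, w))) C os n) :
    RunsWithin δ N (.ok x w m) (.store id :: C) os n := by
  have hs : SimState.step δ (.ok x w m) (.store id) = .ok x w (m.insert id (x, w)) := by
    simp [SimState.step, hid]
  refine ⟨?_, ?_, ?_⟩
  · simp only [List.scanl_cons, List.mem_cons, forall_eq_or_imp, hs]
    exact ⟨⟨by simp, hm⟩, h.ok⟩
  · simp [outputsFrom, hs, h.outputs_eq]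
  · simp [campaignLen, cmdLen, ← h.len_eq]

theorem cons_run {u : U} (hm : m.keys.card ≤ N)
    (h : RunsWithin δ N (.ok (δ x u) (w ++ [u]) m) C os n) :
    RunsWithin δ N (.ok x w m) (.run u 1 :: C) os (n + 1) := by
  have hs : SimState.step δ (.ok x w m) (.run u 1) = .ok (δ x u) (w ++ [u]) m := by
    simp [SimState.step]
  refine ⟨?_, ?_, ?_⟩
  · simp only [List.scanl_cons, List.mem_cons, forall_eq_or_imp, hs]
    exact ⟨⟨by simp, hm⟩, h.ok⟩
  · simp [outputsFrom, hs, h.outputs_eq]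
  · simp [campaignLen, cmdLen, ← h.len_eq, add_comm]

end RunsWithin

/-- The memory `m` stores exactly the traces of `A` that lie in `Q`, each under its identifier
`enc p` and with the system state it leads to. -/
structure StoresVisited (δ : X → U → X) (x0 : X) (A : Finset (List U)) (enc : List U → ID)
    (Q : Finset (List U)) (m : Finmap fun _ : ID => X × List U) : Prop where
  keys_subset : m.keys ⊆ A.image enc
  lookup_mem : ∀ p ∈ A, p ∈ Q → m.lookup (enc p) = some (List.foldl δ x0 p, p)
  lookup_notMem : ∀ p ∈ A, p ∉ Q → m.lookup (enc p) = none

namespace StoresVisited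

variable {δ : X → U → X} {x0 : X} {A Q : Finset (List U)} {enc : List U → ID}
  {m : Finmap fun _ : ID => X × List U}

theorem card_le (h : StoresVisited δ x0 A enc Q m) : m.keys.card ≤ A.card :=
  (Finset.card_le_card h.keys_subset).trans Finset.card_image_le

theorem empty : StoresVisited δ x0 A enc ∅ (∅ : Finmap fun _ : ID => X × List U) :=
  ⟨by simp, by simp, by simp⟩

variable [DecidableEq U]

theorem insert_of_notMem {p : List U} (h : StoresVisited δ x0 A enc Q m) (hp : p ∉ A) :
    StoresVisited δ x0 A enc (insert p Q) m where
  keys_subset := h.keys_subset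
  lookup_mem q hq hqQ := h.lookup_mem q hq (by grind)
  lookup_notMem q hq hqQ := h.lookup_notMem q hq (by grind)

theorem insert_of_mem {p : List U} (h : StoresVisited δ x0 A enc Q m)
    (henc : Set.InjOn enc A) (hp : p ∈ A) :
    StoresVisited δ x0 A enc (insert p Q) (m.insert (enc p) (List.foldl δ x0 p, p)) where
  keys_subset := by
    intro i hi
    rw [Finmap.mem_keys, Finmap.mem_insert] at hi
    rcases hi with rfl | hi
    · exact Finset.mem_image_of_mem _ hp
    · exact h.keys_subset (Finmap.mem_keys.2 hi)
  lookup_mem q hq hqQ := by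
    by_cases hqp : q = p
    · subst hqp
      exact Finmap.lookup_insert m
    · rw [Finmap.lookup_insert_of_ne m fun he => hqp (henc hq hp he)]
      exact h.lookup_mem q hq (by grind)
  lookup_notMem q hq hqQ := by
    have hqp : q ≠ p := by grind
    rw [Finmap.lookup_insert_of_ne m fun he => hqp (henc hq hp he)]
    exact h.lookup_notMem q hq (by grind)

/-- Marking the current, not yet visited, trace as visited costs at most a `store`. -/
theorem exists_mark (henc : Set.InjOn enc A) {p : List U} {os : List (List U)} {n : ℕ}
    (h : StoresVisited δ x0 A enc Q m) (hp : p ∉ Q)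
    (hk : ∀ m', StoresVisited δ x0 A enc (insert p Q) m' →
      ∃ C, RunsWithin δ A.card (.ok (List.foldl δ x0 p) p m') C os n) :
    ∃ C, RunsWithin δ A.card (.ok (List.foldl δ x0 p) p m) C os n := by
  by_cases hpA : p ∈ A
  · obtain ⟨C, hC⟩ := hk _ (h.insert_of_mem henc hpA)
    exact ⟨_, hC.cons_store h.card_le (h.lookup_notMem p hpA hp)⟩
  · exact hk _ (h.insert_of_notMem hpA)

/-- Injecting a suffix `r` none of whose steps has been visited, marking every step. The number
`K` is the number of traces visited at the end of the whole campaign. -/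
theorem exists_extend (henc : Set.InjOn enc A) {os : List (List U)} {K : ℕ} (r : List U)
    {p : List U} (h : StoresVisited δ x0 A enc Q m) (hpQ : p ∈ Q)
    (hr : ∀ s, s <+: r → s ≠ [] → p ++ s ∉ Q)
    (hk : ∀ Q' m', StoresVisited δ x0 A enc Q' m' →
      (∀ y, y ∈ Q' ↔ y ∈ Q ∨ ∃ s, s <+: r ∧ y = p ++ s) →
      ∃ C n, RunsWithin δ A.card (.ok (List.foldl δ x0 (p ++ r)) (p ++ r) m') C os n ∧
        Q'.card + n = K) :
    ∃ C n, RunsWithin δ A.card (.ok (List.foldl δ x0 p) p m) C os n ∧ Q.card + n = K := by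
  induction r generalizing p Q m with
  | nil => simpa using hk Q m h (by simp +contextual [hpQ])
  | cons a r ih =>
    have ha : p ++ [a] ∉ Q := hr [a] (by simp) (by simp)
    have key : ∀ m', StoresVisited δ x0 A enc (insert (p ++ [a]) Q) m' →
        ∃ C n, RunsWithin δ A.card (.ok (List.foldl δ x0 (p ++ [a])) (p ++ [a]) m') C os n ∧
          (insert (p ++ [a]) Q).card + n = K := by
      intro m' hm'
      refine ih hm' (by simp) ?_ ?_
      · intro s hs hs0 hmem
        rw [Finset.mem_insert] at hmem
        rcases hmem with hmem | hmem
        · simp [hs0] at hmem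
        · exact hr (a :: s) (by simpa using hs) (by simp) (by simpa using hmem)
      · intro Q' m'' h' hQ'
        have := hk Q' m'' h' ?_
        · simpa using this
        · intro y
          rw [hQ', Finset.mem_insert]
          constructor
          · rintro ((rfl | hy) | ⟨s, hs, rfl⟩)
            · exact .inr ⟨[a], by simp, rfl⟩
            · exact .inl hy
            · exact .inr ⟨a :: s, by simpa using hs, by simp⟩
          · rintro (hy | ⟨s, hs, rfl⟩)
            · exact .inl (.inr hy)
            · rcases s with _ | ⟨b, s⟩
              · simp [hpQ]
              · rw [List.cons_prefix_cons] at hs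
                obtain ⟨rfl, hs⟩ := hs
                exact .inr ⟨s, hs, by simp⟩
    have hcard := Finset.card_insert_of_notMem ha
    have hKle : Q.card + 1 ≤ K := by
      by_cases hpA : p ++ [a] ∈ A
      · obtain ⟨C, n, -, hn⟩ := key _ (h.insert_of_mem henc hpA)
        omega
      · obtain ⟨C, n, -, hn⟩ := key _ (h.insert_of_notMem hpA)
        omega
    obtain ⟨C, hC⟩ := h.exists_mark henc (n := K - (Q.card + 1)) ha fun m' hm' => by
      obtain ⟨C, n, hC, hn⟩ := key m' hm'
      obtain rfl : n = K - (Q.card + 1) := by omega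
      exact ⟨C, hC⟩
    refine ⟨.run a 1 :: C, _, RunsWithin.cons_run h.card_le (by simpa using hC), by omega⟩

end StoresVisited

/-- The prefix of `T` from which its simulation starts: the longest visited one. -/
theorem exists_maximal_prefix_mem [DecidableEq U] {Q : Finset (List U)} (hQ : [] ∈ Q)
    (T : List U) :
    ∃ p r, T = p ++ r ∧ p ∈ Q ∧ ∀ s ∈ Q, s <+: T → s.length ≤ p.length := by
  obtain ⟨p, hp, hmax⟩ := (Q.filter (· <+: T)).exists_max_image List.length ⟨[], by simp [hQ]⟩
  rw [Finset.mem_filter] at hp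
  obtain ⟨hpQ, r, rfl⟩ := hp
  exact ⟨p, r, rfl, hpQ, fun s hs hsT => hmax s (by simp [hs, hsT])⟩

theorem exists_campaign_of_visited [DecidableEq U] {δ : X → U → X} {x0 : X}
    {L : List (List U)} (hnd : L.Nodup) {A V : Finset (List U)} {enc : List U → ID}
    (henc : Set.InjOn enc A)
    (hA : ∀ a ∈ L, ∀ b ∈ L, a ≠ b → lcp a b ∈ A)
    (hV : ∀ y, y ∈ V ↔ y = [] ∨ ∃ T ∈ L, y <+: T)
    (L' P : List (List U)) (hL : L = P ++ L') {Q : Finset (List U)}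
    (hQ : ∀ y, y ∈ Q ↔ y = [] ∨ ∃ T ∈ P, y <+: T)
    {x : X} {w : List U} {m : Finmap fun _ : ID => X × List U}
    (hinit : P = [] → x = x0 ∧ w = []) (h : StoresVisited δ x0 A enc Q m) :
    ∃ C n, RunsWithin δ A.card (.ok x w m) C L' n ∧ Q.card + n = V.card := by
  induction L' generalizing P Q x w m with
  | nil =>
    obtain rfl : Q = V := by
      ext y
      rw [hQ, hV, hL, List.append_nil]
    exact ⟨[], 0, .nil h.card_le, rfl⟩
  | cons T L' ih =>
    obtain ⟨p, r, hT, hpQ, hmax⟩ := exists_maximal_prefix_mem ((hQ []).2 (.inl rfl)) T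
    have hpT : p <+: T := ⟨r, hT.symm⟩
    have start : ∃ C n, RunsWithin δ A.card (.ok (List.foldl δ x0 p) p m) C (T :: L') n ∧
        Q.card + n = V.card := by
      refine h.exists_extend henc r hpQ ?_ ?_
      · intro s hs hs0 hmem
        have := hmax _ hmem (by rw [hT]; simpa using hs)
        have := List.length_pos_iff.2 hs0
        grind
      · intro Q' m' h' hQ'
        have hQ'' : ∀ y, y ∈ Q' ↔ y = [] ∨ ∃ S ∈ P ++ [T], y <+: S := by
          intro y
          rw [hQ', hQ]
          simp only [List.mem_append, List.mem_singleton, or_and_right, exists_or,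
            exists_eq_left, ← or_assoc]
          refine or_congr_right' fun hy => ?_
          constructor
          · rintro ⟨s, hs, rfl⟩
            rw [hT]
            simpa using hs
          · intro hyT
            obtain ⟨s, rfl⟩ | hyp := (List.prefix_or_prefix_of_prefix hpT hyT)
            · exact ⟨s, by rwa [hT, List.prefix_append_right_inj] at hyT, rfl⟩
            · refine absurd ((hQ y).1 ?_) hy
              rcases (hQ p).1 hpQ with rfl | ⟨T', hT', hpT'⟩
              · rw [List.prefix_nil.1 hyp]; exact hpQ
              · exact (hQ y).2 (.inr ⟨T', hT', hyp.trans hpT'⟩)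
        obtain ⟨C, n, hC, hn⟩ := ih (P ++ [T]) (by simp [hL]) hQ'' (x := List.foldl δ x0 T)
          (w := T) (by simp) h'
        rw [← hT]
        exact ⟨_, n, hC.cons_out h'.card_le, hn⟩
    by_cases hP : P = []
    · obtain ⟨rfl, rfl⟩ := hinit hP
      obtain rfl : p = [] := by simpa [hP] using (hQ p).1 hpQ
      exact start
    · obtain ⟨T', hT'P, hpT'⟩ : ∃ T' ∈ P, p <+: T' := by
        rcases (hQ p).1 hpQ with rfl | hp
        · obtain ⟨T', hT'⟩ := List.exists_mem_of_ne_nil P hP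
          exact ⟨T', hT', by simp⟩
        · exact hp
      have hne : T ≠ T' := by
        rintro rfl
        rw [hL, List.nodup_append] at hnd
        exact hnd.2.2 T hT'P T (by simp) rfl
      have hpl : p = lcp T T' := (prefix_lcp hpT hpT').eq_of_length_le <|
        hmax _ ((hQ _).2 (.inr ⟨T', hT'P, lcp_prefix_right T T'⟩)) (lcp_prefix_left T T')
      have hpA : p ∈ A := hpl ▸ hA T (by simp [hL]) T' (by simp [hL, hT'P]) hne
      obtain ⟨C, n, hC, hn⟩ := start
      exact ⟨_, n, RunsWithin.cons_load h.card_le (h.lookup_mem p hpA hpQ) hC, hn⟩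

theorem foldr_max_le {l : List ℕ} {N : ℕ} (h : ∀ k ∈ l, k ≤ N) : l.foldr max 0 ≤ N := by
  induction l with
  | nil => simp
  | cons a l ih => simp_all

/-- For any finite list `L` of pairwise distinct nonempty input traces,
letting `m*` be the number of distinct longest shared prefixes (LSPs) of the set `S` of
elements of `L`, there exists an executable simulation campaign whose output-trace
sequence is exactly `L`, whose required memory is at most `m*`, and whose length equals
the number of distinct nonempty prefixes of elements of `S`. -/
theorem stmt4 [Countable ID] [Infinite ID] [DecidableEq U] (δ : X → U → X) (x0 : X)
    (L : List (List U)) (hnd : L.Nodup) (hne : ∀ T ∈ L, T ≠ []) :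
    ∃ C : List (SimCmd U ID), Executable δ x0 C ∧ outputs δ x0 C = L ∧
      requiredMem δ x0 C ≤ {p : List U | ∃ a ∈ L, ∃ b ∈ L, a ≠ b ∧ p = lcp a b}.ncard ∧
      campaignLen C = {p : List U | p ≠ [] ∧ ∃ T ∈ L, p <+: T}.ncard := by
  obtain ⟨e, he⟩ := Set.countable_iff_exists_injOn.1 (finite_setOf_lcp L).countable
  set A : Finset (List U) := (finite_setOf_lcp L).toFinset with hAdef
  have henc : Set.InjOn (Infinite.natEmbedding ID ∘ e) A := by
    rw [hAdef, Set.Finite.coe_toFinset]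
    exact (Infinite.natEmbedding ID).injective.comp_injOn he
  set V : Finset (List U) := insert [] (L.toFinset.biUnion fun T => T.inits.toFinset) with hVdef
  have hV : ∀ y, y ∈ V ↔ y = [] ∨ ∃ T ∈ L, y <+: T := by simp [hVdef]
  have hA : ∀ a ∈ L, ∀ b ∈ L, a ≠ b → lcp a b ∈ A := fun a ha b hb hab => by
    rw [hAdef, Set.Finite.mem_toFinset]
    exact ⟨a, ha, b, hb, hab, rfl⟩
  have hVcard : {p : List U | p ≠ [] ∧ ∃ T ∈ L, p <+: T}.ncard + 1 = V.card := by
    have : {p : List U | p ≠ [] ∧ ∃ T ∈ L, p <+: T} = ↑(V.erase []) := by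
      ext y
      simp only [Set.mem_ofPred_eq, Finset.mem_coe, Finset.mem_erase, hV]
      tauto
    rw [this, Set.ncard_coe_finset, Finset.card_erase_add_one (by simp [hVdef])]
  obtain ⟨C, hC⟩ := (StoresVisited.empty (δ := δ) (x0 := x0)).exists_mark henc (p := [])
    (os := L) (n := {p : List U | p ≠ [] ∧ ∃ T ∈ L, p <+: T}.ncard) (by simp) fun m' hm' => by
      obtain ⟨C, n, hC, hn⟩ := exists_campaign_of_visited hnd henc hA hV L [] rfl
        (by simp) (x := x0) (w := []) (by simp) hm'
      simp only [insert_empty_eq, Finset.card_singleton] at hn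
      obtain rfl : n = {p : List U | p ≠ [] ∧ ∃ T ∈ L, p <+: T}.ncard := by omega
      exact ⟨C, hC⟩
  refine ⟨C, fun s hs => (hC.ok s hs).1, hC.outputs_eq, ?_, hC.len_eq⟩
  rw [Set.ncard_eq_toFinset_card _ (finite_setOf_lcp L)]
  exact foldr_max_le fun k hk => by
    obtain ⟨s, hs, rfl⟩ := List.mem_map.1 hk
    exact (hC.ok s hs).2
end
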